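/- For all natural numbers k, ℓ, the function Y(x) = Q^k_ℓ(i·x) satisfies the associated Legendre equation with purely imaginary argument: for all x ∈ ℝ, d/dx[(1+x²)·Y'(x)] − [ℓ(ℓ+1) − k²/(1+x²)]·Y(x) = 0. -/

import Mathlib

open MeasureTheory Filter Finset

/-- Legendre polynomial of the first kind via the Rodrigues formula,
evaluated at a complex argument. -/
noncomputable def legP (l : ℕ) (z : ℂ) : ℂ :=
  (1 / (2 ^ l * (l.factorial : ℂ))) * iteratedDeriv l (fun w : ℂ => (w ^ 2 - 1) ^ l) z

/-- Legendre function of the second kind `Q_ℓ` (Ferrers branch), for complex argument. -/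
noncomputable def legQ (l : ℕ) (z : ℂ) : ℂ :=
  (1 / 2) * legP l z * Complex.log ((1 + z) / (1 - z)) -
    ∑ j ∈ Finset.Icc 1 l, legP (j - 1) z * legP (l - j) z / (j : ℂ)

/-- The associated Legendre function of the second kind on the imaginary axis:
`Q^k_ℓ(i·x) = (−1)^k (1+x²)^{k/2} i^{−k} (d/dx)^k [Q_ℓ(i·x)]`. -/
noncomputable def Qi (k l : ℕ) (x : ℝ) : ℂ :=
  (-1) ^ k * (((1 + x ^ 2) ^ ((k : ℝ) / 2) : ℝ) : ℂ) * Complex.I ^ (-(k : ℤ)) *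
    iteratedDeriv k (fun t : ℝ => legQ l (Complex.I * t)) x

open Polynomial in
/-- The Legendre polynomial `P_ℓ` as an element of `ℂ[X]`. -/
noncomputable def legendrePoly (l : ℕ) : ℂ[X] :=
  C (1 / (2 ^ l * (l.factorial : ℂ))) * derivative^[l] ((X ^ 2 - 1) ^ l)

open Polynomial in
/-- The polynomial part `∑ P_{j-1} P_{ℓ-j} / j` of the Legendre function of the second kind. -/
noncomputable def christoffelPoly (l : ℕ) : ℂ[X] :=
  ∑ j ∈ Finset.Icc 1 l, C ((j : ℂ)⁻¹) * legendrePoly (j - 1) * legendrePoly (l - j)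

section Legendre

open Polynomial

/-- `ℓ` times the antiderivative of `P_ℓ` supplied by the Rodrigues formula. -/
noncomputable def legendreAnti (l : ℕ) : ℂ[X] :=
  C (1 / (2 ^ l * (l.factorial : ℂ))) * (l • derivative^[l - 1] ((X ^ 2 - 1) ^ l))

lemma derivative_legendreAnti (l : ℕ) :
    derivative (legendreAnti l) = (l : ℂ[X]) * legendrePoly l := by
  cases l with
  | zero => simp [legendreAnti]
  | succ n =>
    simp only [legendreAnti, legendrePoly, derivative_C_mul, derivative_smul, Nat.add_sub_cancel,
      ← Function.iterate_succ_apply' derivative]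
    rw [nsmul_eq_mul]
    ring

lemma derivative_X_sq_sub_one_pow (l : ℕ) :
    derivative ((X ^ 2 - 1 : ℂ[X]) ^ (l + 1)) =
      C (2 * ((l : ℂ) + 1)) * ((X ^ 2 - 1) ^ l * X) := by
  simp only [derivative_pow_succ, derivative_sub, derivative_one, map_mul, map_add, map_natCast,
    map_one, C_ofNat]
  simp
  ring

lemma legendrePoly_succ_eq_add_anti (l : ℕ) :
    legendrePoly (l + 1) = X * legendrePoly l + legendreAnti l := by
  have hc : (1 / (2 ^ (l + 1) * ((l + 1).factorial : ℂ))) * (2 * ((l : ℂ) + 1)) =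
      1 / (2 ^ l * (l.factorial : ℂ)) := by
    have := Nat.cast_add_one_ne_zero (R := ℂ) l
    have := Nat.cast_ne_zero (R := ℂ).2 l.factorial_ne_zero
    rw [Nat.factorial_succ]
    push_cast
    field_simp
    ring
  rw [legendrePoly, Function.iterate_succ_apply, derivative_X_sq_sub_one_pow, iterate_derivative_C_mul, ← mul_assoc,
    ← C_mul, hc, iterate_derivative_mul_X, legendrePoly, legendreAnti]
  ring

lemma mul_derivative_legendrePoly_eq_anti (l : ℕ) :
    (X ^ 2 - 1) * derivative (legendrePoly l) = ((l : ℂ[X]) + 1) * legendreAnti l := by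
  cases l with
  | zero => simp [legendreAnti, legendrePoly]
  | succ n =>
    have h : derivative ((X ^ 2 - 1 : ℂ[X]) ^ (n + 1)) * X * X -
        derivative ((X ^ 2 - 1 : ℂ[X]) ^ (n + 1)) =
        C (2 * ((n : ℂ) + 1)) * ((X ^ 2 - 1) ^ (n + 1) * X) := by
      rw [derivative_X_sq_sub_one_pow]
      ring
    replace h := congrArg (derivative^[n + 1]) h
    rw [iterate_derivative_sub, iterate_derivative_C_mul, iterate_derivative_mul_X,
      iterate_derivative_mul_X, iterate_derivative_derivative_mul_X, Nat.add_sub_cancel,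
      iterate_derivative_mul_X, ← Function.iterate_succ_apply derivative,
      ← Function.iterate_succ_apply derivative] at h
    simp only [legendreAnti, legendrePoly, derivative_C_mul, Nat.add_sub_cancel,
      ← Function.iterate_succ_apply' derivative] at h ⊢
    simp only [nsmul_eq_mul, map_mul, map_add, map_natCast, map_one] at h ⊢
    push_cast at h ⊢
    simp only [C_ofNat, Function.iterate_succ_apply'] at h ⊢
    linear_combination C (1 / (2 ^ (n + 1) * ((n + 1).factorial : ℂ))) * h

lemma mul_derivative_legendrePoly (l : ℕ) :
    (X ^ 2 - 1) * derivative (legendrePoly l) =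
      ((l : ℂ[X]) + 1) * (legendrePoly (l + 1) - X * legendrePoly l) := by
  rw [mul_derivative_legendrePoly_eq_anti, legendrePoly_succ_eq_add_anti]
  ring

lemma derivative_legendrePoly_succ (l : ℕ) :
    derivative (legendrePoly (l + 1)) =
      X * derivative (legendrePoly l) + ((l : ℂ[X]) + 1) * legendrePoly l := by
  rw [legendrePoly_succ_eq_add_anti]
  simp only [derivative_add, derivative_mul, derivative_X, derivative_legendreAnti]
  ring

lemma mul_derivative_legendrePoly_succ (l : ℕ) :
    (X ^ 2 - 1) * derivative (legendrePoly (l + 1)) =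
      ((l : ℂ[X]) + 1) * (X * legendrePoly (l + 1) - legendrePoly l) := by
  linear_combination (X ^ 2 - 1) * derivative_legendrePoly_succ l +
    X * mul_derivative_legendrePoly l

lemma legendrePoly_recurrence (l : ℕ) :
    ((l : ℂ[X]) + 2) * legendrePoly (l + 2) =
      (2 * (l : ℂ[X]) + 3) * X * legendrePoly (l + 1) - ((l : ℂ[X]) + 1) * legendrePoly l := by
  have h := mul_derivative_legendrePoly (l + 1)
  push_cast at h
  linear_combination mul_derivative_legendrePoly_succ l - h

@[simp] lemma legendrePoly_zero : legendrePoly 0 = 1 := by simp [legendrePoly]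

@[simp] lemma legendrePoly_one : legendrePoly 1 = X := by
  simp [legendrePoly_succ_eq_add_anti 0, legendreAnti]

end Legendre

section ODE

open Polynomial

lemma legendrePoly_ode (l : ℕ) :
    (X ^ 2 - 1) * derivative (derivative (legendrePoly l)) +
      2 * X * derivative (legendrePoly l) = (l : ℂ[X]) * ((l : ℂ[X]) + 1) * legendrePoly l := by
  have h := congrArg derivative (mul_derivative_legendrePoly_eq_anti l)
  simp [derivative_legendreAnti] at h
  linear_combination h

end ODE

section GeneratingFunction

open PowerSeries

/-- The generating function `∑ P_ℓ t^ℓ`. -/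
noncomputable def legendreGen : PowerSeries (Polynomial ℂ) := mk legendrePoly

/-- The antiderivative in `t` of `∑ P_ℓ t^ℓ` vanishing at `t = 0`. -/
noncomputable def legendreGenInt : PowerSeries (Polynomial ℂ) :=
  PowerSeries.mk fun n => Polynomial.C ((n : ℂ)⁻¹) * legendrePoly (n - 1)

lemma derivative_legendreGenInt : d⁄dX (Polynomial ℂ) legendreGenInt = legendreGen := by
  ext1 n
  have h : (Polynomial.C (((n + 1 : ℕ) : ℂ)⁻¹)) * ((n : Polynomial ℂ) + 1) = 1 := by
    have : ((n : Polynomial ℂ) + 1) = Polynomial.C ((n + 1 : ℕ) : ℂ) := by simp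
    rw [this, ← Polynomial.C_mul, inv_mul_cancel₀ (by exact_mod_cast n.succ_ne_zero),
      Polynomial.C_1]
  simp only [coeff_derivative, legendreGenInt, legendreGen, coeff_mk, Nat.add_sub_cancel]
  linear_combination legendrePoly n * h

lemma legendreGenInt_mul_legendreGen : legendreGenInt * legendreGen = PowerSeries.mk christoffelPoly := by
  ext1 n
  rw [coeff_mul, coeff_mk, christoffelPoly, Finset.Nat.sum_antidiagonal_eq_sum_range_succ_mk,
    Finset.range_eq_Ico, Finset.sum_eq_sum_Ico_succ_bot n.succ_pos]
  simp only [legendreGenInt, legendreGen, coeff_mk]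
  simp
  rfl

lemma coeff_quadratic_mul_derivative_sub (f : ℕ → Polynomial ℂ) (n : ℕ) :
    coeff (n + 1) ((1 - 2 * C Polynomial.X * X + X ^ 2) * d⁄dX (Polynomial ℂ) (PowerSeries.mk f) -
      (C Polynomial.X - X) * PowerSeries.mk f) =
      ((n : Polynomial ℂ) + 2) * f (n + 2) -
        (2 * (n : Polynomial ℂ) + 3) * Polynomial.X * f (n + 1) +
        ((n : Polynomial ℂ) + 1) * f n := by
  have h : (1 - 2 * C Polynomial.X * X + X ^ 2) * d⁄dX (Polynomial ℂ) (PowerSeries.mk f) -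
      (C Polynomial.X - X) * PowerSeries.mk f = d⁄dX (Polynomial ℂ) (PowerSeries.mk f) -
        C (2 * Polynomial.X) * (X * d⁄dX (Polynomial ℂ) (PowerSeries.mk f)) +
        X * (X * d⁄dX (Polynomial ℂ) (PowerSeries.mk f)) - C Polynomial.X * PowerSeries.mk f + X * PowerSeries.mk f := by
    simp only [map_mul, map_ofNat]
    ring
  rw [h]
  cases n with
  | zero =>
    simp only [map_add, map_sub, coeff_C_mul, coeff_succ_X_mul, coeff_zero_X_mul,
      coeff_derivative, coeff_mk]
    push_cast
    ring
  | succ n =>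
    simp only [map_add, map_sub, coeff_C_mul, coeff_succ_X_mul, coeff_derivative, coeff_mk]
    push_cast
    ring

lemma constantCoeff_quadratic_mul_derivative_sub (f : ℕ → Polynomial ℂ) :
    coeff 0 ((1 - 2 * C Polynomial.X * X + X ^ 2) * d⁄dX (Polynomial ℂ) (PowerSeries.mk f) -
      (C Polynomial.X - X) * PowerSeries.mk f) = f 1 - Polynomial.X * f 0 := by
  have h : constantCoeff (d⁄dX (Polynomial ℂ) (PowerSeries.mk f)) = f 1 := by
    rw [← coeff_zero_eq_constantCoeff_apply, coeff_derivative]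
    simp
  simp [h]

lemma quadratic_mul_derivative_legendreGen :
    (1 - 2 * C Polynomial.X * X + X ^ 2) * d⁄dX (Polynomial ℂ) legendreGen =
      (C Polynomial.X - X) * legendreGen := by
  rw [← sub_eq_zero]
  ext1 n
  cases n with
  | zero => rw [legendreGen, constantCoeff_quadratic_mul_derivative_sub]; simp
  | succ n =>
    rw [legendreGen, coeff_quadratic_mul_derivative_sub, map_zero]
    linear_combination legendrePoly_recurrence n

lemma quadratic_mul_legendreGen_sq :
    (1 - 2 * C Polynomial.X * X + X ^ 2) * legendreGen ^ 2 = 1 := by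
  apply derivative.ext
  · have h2 : d⁄dX (Polynomial ℂ) (2 : PowerSeries (Polynomial ℂ)) = 0 := by
      rw [← map_ofNat (C (R := Polynomial ℂ)), derivative_C]
    have h := quadratic_mul_derivative_legendreGen
    simp only [Derivation.leibniz, Derivation.leibniz_pow, map_add, map_sub, derivative_C,
      derivative_X, derivative_one, h2, smul_eq_mul, nsmul_eq_mul]
    push_cast
    linear_combination 2 * legendreGen * h
  · simp [legendreGen]

lemma christoffelPoly_recurrence (n : ℕ) :
    ((n : Polynomial ℂ) + 2) * christoffelPoly (n + 2) =
      (2 * (n : Polynomial ℂ) + 3) * Polynomial.X * christoffelPoly (n + 1) -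
        ((n : Polynomial ℂ) + 1) * christoffelPoly n := by
  have h : (1 - 2 * C Polynomial.X * X + X ^ 2) * d⁄dX (Polynomial ℂ) (PowerSeries.mk christoffelPoly) -
      (C Polynomial.X - X) * PowerSeries.mk christoffelPoly = 1 := by
    rw [← legendreGenInt_mul_legendreGen]
    simp only [Derivation.leibniz, derivative_legendreGenInt, smul_eq_mul]
    linear_combination quadratic_mul_legendreGen_sq +
      legendreGenInt * quadratic_mul_derivative_legendreGen
  have hn := congrArg (coeff (n + 1)) h
  rw [coeff_quadratic_mul_derivative_sub, coeff_one, if_neg n.succ_ne_zero] at hn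
  linear_combination hn

end GeneratingFunction

section Christoffel

open Polynomial

@[simp] lemma christoffelPoly_zero : christoffelPoly 0 = 0 := by simp [christoffelPoly]

@[simp] lemma christoffelPoly_one : christoffelPoly 1 = 1 := by simp [christoffelPoly]

lemma mul_derivative_christoffelPoly_pair (l : ℕ) :
    (X ^ 2 - 1) * derivative (christoffelPoly l) =
        ((l : ℂ[X]) + 1) * (christoffelPoly (l + 1) - X * christoffelPoly l) - legendrePoly l ∧
      (X ^ 2 - 1) * derivative (christoffelPoly (l + 1)) =
        ((l : ℂ[X]) + 1) * (X * christoffelPoly (l + 1) - christoffelPoly l) -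
          legendrePoly (l + 1) := by
  induction l with
  | zero => simp
  | succ l ih =>
    obtain ⟨hB, hA⟩ := ih
    have hrec := christoffelPoly_recurrence l
    have hl : ((l : ℂ[X]) + 2) ≠ 0 := by
      exact_mod_cast (l + 1).succ_ne_zero
    have hd := congrArg derivative hrec
    simp only [derivative_mul, derivative_add, derivative_sub, derivative_natCast, derivative_X,
      derivative_ofNat, derivative_one] at hd
    constructor
    · push_cast
      linear_combination hA - hrec
    · apply mul_left_cancel₀ hl
      push_cast
      linear_combination (X ^ 2 - 1) * hd + (2 * (l : ℂ[X]) + 3) * X * hA -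
        ((l : ℂ[X]) + 1) * hB - ((l : ℂ[X]) + 2) * X * hrec + legendrePoly_recurrence l

lemma christoffelPoly_ode (l : ℕ) :
    (X ^ 2 - 1) * derivative (derivative (christoffelPoly l)) +
      2 * X * derivative (christoffelPoly l) =
      (l : ℂ[X]) * ((l : ℂ[X]) + 1) * christoffelPoly l - 2 * derivative (legendrePoly l) := by
  cases l with
  | zero => simp
  | succ l =>
    obtain ⟨hB, hA⟩ := mul_derivative_christoffelPoly_pair l
    have hd := congrArg derivative hA
    simp only [derivative_mul, derivative_add, derivative_sub, derivative_natCast, derivative_X,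
      derivative_X_pow, derivative_one] at hd
    simp only [Nat.cast_ofNat, C_ofNat, Nat.add_one_sub_one, pow_one] at hd
    have hu : (X ^ 2 - 1 : ℂ[X]) ≠ 0 := X_pow_sub_C_ne_zero two_pos 1
    apply mul_left_cancel₀ hu
    push_cast
    linear_combination (X ^ 2 - 1) * hd + ((l : ℂ[X]) + 1) * (X * hA - hB) +
      mul_derivative_legendrePoly_succ l

end Christoffel

section Analysis

open Complex

lemma iteratedDeriv_eval (p : Polynomial ℂ) (n : ℕ) :
    iteratedDeriv n (fun z => p.eval z) = fun z => (Polynomial.derivative^[n] p).eval z := by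
  induction n with
  | zero => simp
  | succ n ih =>
    rw [iteratedDeriv_succ, ih, Function.iterate_succ_apply']
    ext z
    exact Polynomial.deriv _

lemma legP_eq_eval (l : ℕ) (z : ℂ) : legP l z = (legendrePoly l).eval z := by
  have h := iteratedDeriv_eval ((Polynomial.X ^ 2 - 1) ^ l) l
  simp only [Polynomial.eval_pow, Polynomial.eval_sub, Polynomial.eval_X,
    Polynomial.eval_one] at h
  simp [legP, legendrePoly, h]

lemma legQ_I_mul (l : ℕ) (t : ℝ) :
    legQ l (I * t) = I * (Real.arctan t : ℂ) * (legendrePoly l).eval (I * (t : ℂ)) -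
      (christoffelPoly l).eval (I * (t : ℂ)) := by
  have hlog : (1 / 2 : ℂ) * Complex.log ((1 + I * t) / (1 - I * t)) =
      I * (Real.arctan t : ℂ) := by
    rw [Complex.ofReal_arctan, Complex.arctan, mul_comm I (t : ℂ)]
    linear_combination (1 / 2 : ℂ) * Complex.log ((1 + t * I) / (1 - t * I)) * I_sq
  simp only [legQ, legP_eq_eval, christoffelPoly, Polynomial.eval_finsetSum,
    Polynomial.eval_mul, Polynomial.eval_C]
  congr 1
  · linear_combination (legendrePoly l).eval (I * (t : ℂ)) * hlog
  · exact Finset.sum_congr rfl fun j _ => by ring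

lemma hasDerivAt_eval_I_mul (p : Polynomial ℂ) (t : ℝ) :
    HasDerivAt (fun s : ℝ => p.eval (I * (s : ℂ)))
      (I * (Polynomial.derivative p).eval (I * (t : ℂ))) t := by
  have h : HasDerivAt (fun z : ℂ => p.eval (I * z))
      ((Polynomial.derivative p).eval (I * (t : ℂ)) * (I * 1)) (t : ℂ) :=
    (p.hasDerivAt (I * (t : ℂ))).comp (t : ℂ) ((hasDerivAt_id (t : ℂ)).const_mul I)
  convert h.comp_ofReal using 1
  ring

lemma one_add_ofReal_sq_ne_zero (t : ℝ) : (1 + (t : ℂ) ^ 2) ≠ 0 := by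
  exact_mod_cast (by positivity : (1 + t ^ 2 : ℝ) ≠ 0)

lemma hasDerivAt_one_add_ofReal_sq (t : ℝ) :
    HasDerivAt (fun s : ℝ => 1 + (s : ℂ) ^ 2) (2 * (t : ℂ)) t := by
  simpa using ((hasDerivAt_pow 2 (t : ℂ)).const_add 1).comp_ofReal

lemma hasDerivAt_ofReal_arctan (t : ℝ) :
    HasDerivAt (fun s : ℝ => (Real.arctan s : ℂ)) (1 / (1 + (t : ℂ) ^ 2)) t := by
  simpa using (Real.hasDerivAt_arctan t).ofReal_comp

lemma contDiff_legQ_I_mul (l : ℕ) (n : WithTop ℕ∞) :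
    ContDiff ℝ n (fun t : ℝ => legQ l (I * t)) := by
  have hp (p : Polynomial ℂ) : ContDiff ℝ n (fun t : ℝ => p.eval (I * (t : ℂ))) := by
    have h : ContDiff ℂ n (fun z : ℂ => p.eval z) := p.contDiff_aeval n
    exact (h.restrict_scalars ℝ).comp (contDiff_const.mul ofRealCLM.contDiff)
  simp only [legQ_I_mul]
  exact ((contDiff_const.mul (ofRealCLM.contDiff.comp Real.contDiff_arctan)).mul (hp _)).sub
    (hp _)

lemma legQ_I_mul_ode (l : ℕ) (t : ℝ) :
    (1 + (t : ℂ) ^ 2) * iteratedDeriv 2 (fun s : ℝ => legQ l (I * s)) t +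
      2 * t * iteratedDeriv 1 (fun s : ℝ => legQ l (I * s)) t =
      (l : ℂ) * (l + 1) * legQ l (I * t) := by
  set p := legendrePoly l with hp
  set h := christoffelPoly l with hh
  have h1 : deriv (fun s : ℝ => legQ l (I * s)) = fun s : ℝ =>
      I * (1 / (1 + (s : ℂ) ^ 2)) * p.eval (I * (s : ℂ)) +
        I * (Real.arctan s : ℂ) * (I * (Polynomial.derivative p).eval (I * (s : ℂ))) -
        I * (Polynomial.derivative h).eval (I * (s : ℂ)) := by
    ext s
    simp only [legQ_I_mul]
    exact ((((hasDerivAt_ofReal_arctan s).const_mul I).mul (hasDerivAt_eval_I_mul p s)).sub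
      (hasDerivAt_eval_I_mul h s)).deriv
  have hs := one_add_ofReal_sq_ne_zero t
  have hinv : HasDerivAt (fun s : ℝ => 1 / (1 + (s : ℂ) ^ 2))
      (-(2 * t) / (1 + (t : ℂ) ^ 2) ^ 2) t := by
    simpa only [one_div] using (hasDerivAt_one_add_ofReal_sq t).fun_inv hs
  have h2 := ((((hinv.const_mul I).mul (hasDerivAt_eval_I_mul p t)).add
    (((hasDerivAt_ofReal_arctan t).const_mul I).mul
      ((hasDerivAt_eval_I_mul (Polynomial.derivative p) t).const_mul I))).sub
    ((hasDerivAt_eval_I_mul (Polynomial.derivative h) t).const_mul I)).deriv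
  rw [iteratedDeriv_succ, iteratedDeriv_one, h1]
  erw [h2]
  rw [legQ_I_mul]
  have eP := congrArg (Polynomial.eval (I * (t : ℂ))) (legendrePoly_ode l)
  have eH := congrArg (Polynomial.eval (I * (t : ℂ))) (christoffelPoly_ode l)
  simp only [← hp, ← hh, Polynomial.eval_add, Polynomial.eval_sub, Polynomial.eval_mul,
    Polynomial.eval_pow, Polynomial.eval_X, Polynomial.eval_one, Polynomial.eval_natCast,
    Polynomial.eval_ofNat] at eP eH ⊢
  generalize p.eval (I * (t : ℂ)) = P0 at *
  generalize (Polynomial.derivative p).eval (I * (t : ℂ)) = P1 at *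
  generalize (Polynomial.derivative (Polynomial.derivative p)).eval (I * (t : ℂ)) = P2 at *
  generalize h.eval (I * (t : ℂ)) = H0 at *
  generalize (Polynomial.derivative h).eval (I * (t : ℂ)) = H1 at *
  generalize (Polynomial.derivative (Polynomial.derivative h)).eval (I * (t : ℂ)) = H2 at *
  rw [mul_pow, I_sq] at eP eH
  have hm : (1 + (t : ℂ) ^ 2) * (1 / (1 + (t : ℂ) ^ 2)) = 1 := mul_one_div_cancel hs
  have hm2 : (1 + (t : ℂ) ^ 2) * (-(2 * t) / (1 + (t : ℂ) ^ 2) ^ 2) =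
      -(2 * t) * (1 / (1 + (t : ℂ) ^ 2)) := by
    field_simp
  generalize -(2 * (t : ℂ)) / (1 + (t : ℂ) ^ 2) ^ 2 = v at *
  generalize 1 / (1 + (t : ℂ) ^ 2) = w at *
  linear_combination I * (Real.arctan t : ℂ) * eP - eH + I * P0 * hm2 + 2 * I ^ 2 * P1 * hm +
    (I * (Real.arctan t : ℂ) * (1 + (t : ℂ) ^ 2) * P2 - (1 + (t : ℂ) ^ 2) * H2 + 2 * P1) * I_sq

lemma hasDerivAt_iteratedDeriv_legQ (k l : ℕ) (x : ℝ) :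
    HasDerivAt (iteratedDeriv k (fun s : ℝ => legQ l (I * s)))
      (iteratedDeriv (k + 1) (fun s : ℝ => legQ l (I * s)) x) x := by
  rw [iteratedDeriv_succ]
  exact ((contDiff_legQ_I_mul l (k + 1 : ℕ)).differentiable_iteratedDeriv k
    (by exact_mod_cast k.lt_succ_self) x).hasDerivAt

lemma iteratedDeriv_legQ_I_mul_ode (k l : ℕ) (x : ℝ) :
    (1 + (x : ℂ) ^ 2) * iteratedDeriv (k + 2) (fun s : ℝ => legQ l (I * s)) x +
      2 * (k + 1) * x * iteratedDeriv (k + 1) (fun s : ℝ => legQ l (I * s)) x +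
      k * (k + 1) * iteratedDeriv k (fun s : ℝ => legQ l (I * s)) x =
      (l : ℂ) * (l + 1) * iteratedDeriv k (fun s : ℝ => legQ l (I * s)) x := by
  induction k generalizing x with
  | zero => simpa using legQ_I_mul_ode l x
  | succ k ih =>
    have hid : HasDerivAt (fun s : ℝ => 2 * ((k : ℂ) + 1) * (s : ℂ))
        (2 * ((k : ℂ) + 1) * 1) x :=
      ((hasDerivAt_id (x : ℂ)).const_mul _).comp_ofReal
    have hL := (((hasDerivAt_one_add_ofReal_sq x).mul (hasDerivAt_iteratedDeriv_legQ (k + 2) l x)).add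
      (hid.mul (hasDerivAt_iteratedDeriv_legQ (k + 1) l x))).add
      ((hasDerivAt_iteratedDeriv_legQ k l x).const_mul ((k : ℂ) * (k + 1)))
    have hR := (hasDerivAt_iteratedDeriv_legQ k l x).const_mul ((l : ℂ) * (l + 1))
    have h := hL.unique (hR.congr_of_eventuallyEq (Filter.Eventually.of_forall ih))
    push_cast
    linear_combination h

lemma hasDerivAt_one_add_sq_rpow (k x : ℝ) :
    HasDerivAt (fun t : ℝ => (((1 + t ^ 2) ^ (k / 2) : ℝ) : ℂ))
      (k * x * (((1 + x ^ 2) ^ (k / 2) : ℝ) : ℂ) / (1 + (x : ℂ) ^ 2)) x := by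
  have hpos : (0 : ℝ) < 1 + x ^ 2 := by positivity
  have hq : HasDerivAt (fun s : ℝ => 1 + s ^ 2) (2 * x) x := by
    simpa using (hasDerivAt_pow 2 x).const_add 1
  convert (hq.rpow_const (p := k / 2) (Or.inl hpos.ne')).ofReal_comp using 1
  rw [Real.rpow_sub_one hpos.ne']
  push_cast
  ring

end Analysis

/-- `x ↦ Q^k_ℓ(i·x)` satisfies the associated Legendre equation with purely
imaginary argument. -/
theorem associatedLegendreQ_imag_ODE (k l : ℕ) (x : ℝ) :
    deriv (fun t : ℝ => ((1 + t ^ 2 : ℝ) : ℂ) * deriv (fun s : ℝ => Qi k l s) t) x -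
      ((l : ℂ) * ((l : ℂ) + 1) - (k : ℂ) ^ 2 / ((1 + x ^ 2 : ℝ) : ℂ)) * Qi k l x = 0 := by
  set g : ℕ → ℝ → ℂ := fun n => iteratedDeriv n (fun s : ℝ => legQ l (Complex.I * s)) with hg
  set c : ℂ := (-1) ^ k * Complex.I ^ (-(k : ℤ)) with hc
  set w : ℝ → ℂ := fun t => (((1 + t ^ 2) ^ ((k : ℝ) / 2) : ℝ) : ℂ) with hw
  have hQ (t : ℝ) : Qi k l t = c * (w t * g k t) := by
    simp only [Qi, hg, hc, hw]
    ring
  have hdw (t : ℝ) : HasDerivAt w (k * t * w t / (1 + (t : ℂ) ^ 2)) t := by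
    simpa using hasDerivAt_one_add_sq_rpow k t
  have hdg (n : ℕ) (t : ℝ) : HasDerivAt (g n) (g (n + 1) t) t :=
    hasDerivAt_iteratedDeriv_legQ n l t
  have hid : HasDerivAt (fun s : ℝ => (k : ℂ) * (s : ℂ)) ((k : ℂ) * 1) x :=
    ((hasDerivAt_id (x : ℂ)).const_mul _).comp_ofReal
  have h1 : (fun t : ℝ => ((1 + t ^ 2 : ℝ) : ℂ) * deriv (fun s : ℝ => Qi k l s) t) =
      fun t : ℝ => c * (w t * (k * t * g k t + (1 + (t : ℂ) ^ 2) * g (k + 1) t)) := by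
    ext t
    have ht := one_add_ofReal_sq_ne_zero t
    simp only [hQ]
    rw [(((hdw t).fun_mul (hdg k t)).const_mul c).deriv]
    push_cast
    field_simp
  have h2 := (((hdw x).fun_mul
    ((hid.fun_mul (hdg k x)).fun_add
      ((hasDerivAt_one_add_ofReal_sq x).fun_mul (hdg (k + 1) x)))).const_mul c).deriv
  rw [h1, h2, hQ]
  have hx := one_add_ofReal_sq_ne_zero x
  have hode : (1 + (x : ℂ) ^ 2) * g (k + 2) x + 2 * (k + 1) * x * g (k + 1) x +
      k * (k + 1) * g k x = (l : ℂ) * (l + 1) * g k x := iteratedDeriv_legQ_I_mul_ode k l x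
  push_cast
  field_simp
  linear_combination c * w x * (1 + (x : ℂ) ^ 2) * hode
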